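/- Let G be a finite simple graph with maximum degree Δ ≥ 2 and fix a vertex v and an integer L ≥ 1. Then the number of vertex subsets S with v ∈ S, |S| ≤ L, and S inducing a connected subgraph of G is at most (L · Δ)^(L-1) (in particular it is bounded by a polynomial in Δ for fixed L, and the total number of connected subsets of size at most L is at most |V(G)| · (L·Δ)^(L-1)). -/

import Mathlib

open scoped Classical

theorem css_exists_pred {V : Type*} [DecidableEq V] (G : SimpleGraph V) (v : V) (S : Finset V)
    (hv : v ∈ S) (hS : (G.induce (↑S : Set V)).Connected) (hne : S ≠ {v}) :
    ∃ T : Finset V, v ∈ T ∧ (G.induce (↑T : Set V)).Connected ∧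
      ∃ a ∈ T, ∃ w, w ∉ T ∧ G.Adj a w ∧ S = insert w T := by
  classical
  let F := S.powerset.filter fun T : Finset V =>
    v ∈ T ∧ T ≠ S ∧ (G.induce (↑T : Set V)).Connected
  have hF : F.Nonempty := by
    refine ⟨{v}, ?_⟩
    simp only [F, Finset.mem_filter, Finset.mem_powerset, Finset.singleton_subset_iff,
      Finset.mem_singleton, true_and]
    refine ⟨hv, fun h => hne h.symm, ?_⟩
    rw [Finset.coe_singleton]
    exact ⟨SimpleGraph.Preconnected.of_subsingleton⟩
  obtain ⟨T, hTF, hmax⟩ := F.exists_max_image Finset.card hF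
  simp only [F, Finset.mem_filter, Finset.mem_powerset] at hTF hmax
  obtain ⟨hTS, hvT, hTne, hTc⟩ := hTF
  obtain ⟨x, hxS, hxT⟩ : ∃ x ∈ S, x ∉ T := by
    by_contra! h
    exact hTne (Finset.Subset.antisymm hTS h)
  obtain ⟨p⟩ := hS.preconnected ⟨v, hv⟩ ⟨x, hxS⟩
  obtain ⟨d, -, hd1, hd2⟩ := p.exists_boundary_dart {y | y.1 ∈ T} hvT hxT
  have hadj : G.Adj d.fst.1 d.snd.1 := d.adj
  refine ⟨T, hvT, hTc, d.fst.1, hd1, d.snd.1, hd2, hadj, ?_⟩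
  have hd2' : d.snd.1 ∉ T := hd2
  by_contra hcon
  have hc : (G.induce (↑(insert d.snd.1 T) : Set V)).Connected := by
    have := SimpleGraph.connected_induce_union (G := G) (s := (↑T : Set V)) (t := {d.snd.1})
      hTc.preconnected SimpleGraph.Preconnected.of_subsingleton hd1 rfl hadj
    rw [Finset.coe_insert, Set.insert_eq, Set.union_comm]
    exact this
  have := hmax (insert d.snd.1 T) ⟨Finset.insert_subset d.snd.2 hTS,
    Finset.mem_insert_of_mem hvT, fun h => hcon h.symm, hc⟩
  rw [Finset.card_insert_of_notMem hd2'] at this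
  omega

/-- Let `G` be a finite simple graph with maximum degree `Δ ≥ 2`, fix a
vertex `v` and an integer `L ≥ 1`. The number of vertex subsets `S` with `v ∈ S`, `|S| ≤ L`
and `S` inducing a connected subgraph of `G` is at most `(L * Δ) ^ (L - 1)`. -/
theorem connected_subsets_through_vertex_bound {V : Type*} [Fintype V] [DecidableEq V]
    (G : SimpleGraph V) [DecidableRel G.Adj] (Δ : ℕ) (hΔ : G.maxDegree = Δ) (hΔ2 : 2 ≤ Δ)
    (v : V) (L : ℕ) (hL : 1 ≤ L) :
    (Finset.univ.filter fun S : Finset V =>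
        v ∈ S ∧ S.card ≤ L ∧ (G.induce (↑S : Set V)).Connected).card
      ≤ (L * Δ) ^ (L - 1) := by
  classical
  induction L, hL using Nat.le_induction with
  | base =>
    simp only [Nat.sub_self, pow_zero]
    refine Finset.card_le_one.2 ?_
    have key : ∀ S : Finset V, v ∈ S → S.card ≤ 1 → S = {v} := fun S h1 h2 =>
      Finset.eq_singleton_iff_unique_mem.2 ⟨h1, fun x hx => Finset.card_le_one.1 h2 x hx v h1⟩
    intro S hS T hT
    simp only [Finset.mem_filter] at hS hT
    rw [key S hS.2.1 hS.2.2.1, key T hT.2.1 hT.2.2.1]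
  | succ L hL ih =>
    let N : Finset V → Finset V := fun T => T.biUnion fun a => G.neighborFinset a
    let E : Finset V → Finset (Finset V) := fun T => insert T ((N T).image fun w => insert w T)
    have hE : ∀ T : Finset V, T.card ≤ L → (E T).card ≤ L * Δ + 1 := by
      intro T hT
      refine (Finset.card_insert_le _ _).trans ?_
      gcongr
      refine Finset.card_image_le.trans ?_
      refine (Finset.card_biUnion_le_card_mul _ _ Δ fun a _ => ?_).trans
        (Nat.mul_le_mul_right _ hT)
      rw [G.card_neighborFinset_eq_degree, ← hΔ]
      exact G.degree_le_maxDegree a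
    have hsub : (Finset.univ.filter fun S : Finset V =>
        v ∈ S ∧ S.card ≤ L + 1 ∧ (G.induce (↑S : Set V)).Connected) ⊆
        (Finset.univ.filter fun S : Finset V =>
        v ∈ S ∧ S.card ≤ L ∧ (G.induce (↑S : Set V)).Connected).biUnion E := by
      intro S hS
      simp only [Finset.mem_filter, Finset.mem_univ, true_and] at hS
      obtain ⟨hv, hc, hS⟩ := hS
      simp only [Finset.mem_biUnion, Finset.mem_filter, Finset.mem_univ, true_and]
      by_cases h : S = {v}
      · exact ⟨S, ⟨hv, by rw [h]; simpa using hL, hS⟩, Finset.mem_insert_self _ _⟩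
      · obtain ⟨T, hvT, hT, a, ha, w, hw, haw, rfl⟩ := css_exists_pred G v S hv hS h
        rw [Finset.card_insert_of_notMem hw] at hc
        refine ⟨T, ⟨hvT, by omega, hT⟩, Finset.mem_insert_of_mem (Finset.mem_image.2 ⟨w, ?_, rfl⟩)⟩
        exact Finset.mem_biUnion.2 ⟨a, ha, by simpa using haw⟩
    refine (Finset.card_le_card hsub).trans ?_
    refine (Finset.card_biUnion_le_card_mul _ _ (L * Δ + 1) fun T hT => hE T ?_).trans ?_
    · simp only [Finset.mem_filter] at hT
      exact hT.2.2.1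
    · refine (Nat.mul_le_mul_right _ ih).trans ?_
      obtain ⟨k, rfl⟩ : ∃ k, L = k + 1 := ⟨L - 1, by omega⟩
      simp only [Nat.add_sub_cancel]
      rw [pow_succ ((k + 1 + 1) * Δ) k]
      refine Nat.mul_le_mul (Nat.pow_le_pow_left (Nat.mul_le_mul_right _ (by omega)) _) ?_
      rw [Nat.add_mul (k + 1) 1 Δ]
      omega
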